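/- arXiv:2605.02836 — 5 statements merged into one kernel-verified Lean document; each statement's English description precedes it below -/
import Mathlib

section
/- Let N ≥ 1 be an integer and let 0 < R₁ < R₂ < … < R_N < L be real numbers. Set d_i := R_i − R₁ for 1 ≤ i ≤ N and d_{N+1} := L − R₁. For a weight vector t = (t₁,…,t_N) with t_k ≥ 0 and Σ_{k=1}^N t_k = 1, define the partial sums S_i(t) := Σ_{k<i} t_k R_k² (for 2 ≤ i ≤ N+1) and the distortion slope λ(t) := (1/48) · min( min_{2≤i≤N} √(S_i(t))/d_i , √(S_{N+1}(t))/d_{N+1} ), where the inner minimum over 2 ≤ i ≤ N is interpreted as +∞ when N = 1. Then the equimarginal allocation t*_k := c² (d_{k+1}² − d_k²)/R_k², with normalization c² := (Σ_{k=1}^N (d_{k+1}² − d_k²)/R_k²)^{-1}, satisfies: (i) t*_k > 0 for every k and Σ_k t*_k = 1 (feasibility); (ii) S_i(t*) = c² d_i² for every i ∈ {2,…,N+1}, so that all ratios appearing in λ are simultaneously equal and λ(t*) = c/48; and (iii) t* is the unique maximizer of λ over the set of feasible weight vectors. -/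
lemma aux_unique (N : ℕ) (R v : ℕ → ℝ) (hpos : ∀ k < N, 0 < R k)
    (hmono : ∀ i j : ℕ, i < j → j < N → R i < R j)
    (hP : ∀ j, 1 ≤ j → j ≤ N → 0 ≤ ∑ k ∈ Finset.range j, v k * (R k) ^ 2) :
    ∀ n, n + 1 ≤ N →
      (∑ k ∈ Finset.range (n + 1), v k * (R k) ^ 2
        ≤ (∑ k ∈ Finset.range (n + 1), v k) * (R n) ^ 2) ∧
      (∑ k ∈ Finset.range (n + 1), v k = 0 → ∀ k < n + 1, v k = 0) := by
  intro n
  induction n with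
  | zero =>
    intro _
    refine ⟨by simp, ?_⟩
    intro h k hk
    obtain rfl : k = 0 := by omega
    simpa using h
  | succ n ih =>
    intro hn
    obtain ⟨ih1, ih2⟩ := ih (by omega)
    have hP1 := hP (n + 1) (by omega) (by omega)
    have hP2 := hP (n + 1 + 1) (by omega) (by omega)
    rw [Finset.sum_range_succ] at hP2
    rw [Finset.sum_range_succ, Finset.sum_range_succ _ (n + 1)]
    set a := ∑ k ∈ Finset.range (n + 1), v k
    set P := ∑ k ∈ Finset.range (n + 1), v k * (R k) ^ 2
    have h0 := hpos n (by omega)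
    have h1 := hmono n (n + 1) (by omega) (by omega)
    have hsq : (R n) ^ 2 < (R (n + 1)) ^ 2 := by nlinarith
    have ha : 0 ≤ a := by
      by_contra h
      push Not at h
      nlinarith [mul_pos (neg_pos.2 h) (pow_pos h0 2)]
    have hle := mul_le_mul_of_nonneg_left hsq.le ha
    refine ⟨by nlinarith, ?_⟩
    intro h
    have hv : v (n + 1) = - a := by linarith
    have ha0 : a = 0 := by
      by_contra hne
      have hap : 0 < a := lt_of_le_of_ne ha (Ne.symm hne)
      have := mul_lt_mul_of_pos_left hsq hap
      rw [hv] at hP2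
      linarith
    intro k hk
    rcases Nat.lt_succ_iff_lt_or_eq.1 hk with hk | rfl
    · exact ih2 ha0 k hk
    · rw [hv, ha0, neg_zero]

/-- Closed-form scale weights: the equimarginal allocation
`t*_k = c² (d_{k+1}² − d_k²)/R_k²` is feasible, equalizes all ratios in the
distortion slope `λ`, and is the unique maximizer of `λ` over feasible weights.
Indices are 0-based: `R 0, …, R (N-1)` are the scales (the paper's `R₁,…,R_N`),
`d j = R j - R 0` for `j < N` and `d j = L - R 0` otherwise (the paper's
`d_{j+1}`), and `S t i = Σ_{k<i} t_k R_k²` (the paper's `S_{i+1}`). -/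
theorem stmt0 (N : ℕ) (hN : 1 ≤ N) (L : ℝ) (R : ℕ → ℝ)
    (hR0 : 0 < R 0)
    (hmono : ∀ i j : ℕ, i < j → j < N → R i < R j)
    (hRL : ∀ k, k < N → R k < L)
    (d : ℕ → ℝ) (hd : ∀ j, d j = if j < N then R j - R 0 else L - R 0)
    (S : (ℕ → ℝ) → ℕ → ℝ)
    (hS : ∀ t i, S t i = ∑ k ∈ Finset.range i, t k * (R k) ^ 2)
    (lam : (ℕ → ℝ) → ℝ)
    (hlam : ∀ t, lam t = (1 / 48) *
      Finset.inf' (Finset.Icc 1 N) (Finset.nonempty_Icc.mpr hN)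
        (fun j => Real.sqrt (S t j) / d j))
    (c2 : ℝ)
    (hc2 : c2 = (∑ k ∈ Finset.range N, ((d (k + 1)) ^ 2 - (d k) ^ 2) / (R k) ^ 2)⁻¹)
    (tstar : ℕ → ℝ)
    (htstar : ∀ k, tstar k = c2 * ((d (k + 1)) ^ 2 - (d k) ^ 2) / (R k) ^ 2) :
    (∀ k < N, 0 < tstar k) ∧
    (∑ k ∈ Finset.range N, tstar k = 1) ∧
    (∀ i, 1 ≤ i → i ≤ N → S tstar i = c2 * (d i) ^ 2) ∧
    (lam tstar = Real.sqrt c2 / 48) ∧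
    (∀ t : ℕ → ℝ, (∀ k < N, 0 ≤ t k) → (∑ k ∈ Finset.range N, t k = 1) →
      lam t ≤ lam tstar ∧ (lam t = lam tstar → ∀ k < N, t k = tstar k)) := by
  have hpos : ∀ k < N, 0 < R k := by
    intro k hk
    rcases Nat.eq_zero_or_pos k with rfl | h
    · exact hR0
    · exact hR0.trans (hmono 0 k h hk)
  have hd0 : d 0 = 0 := by rw [hd, if_pos (by omega), sub_self]
  have hdlt : ∀ k < N, d k < d (k + 1) := by
    intro k hk
    rw [hd k, hd (k + 1), if_pos hk]
    split_ifs with h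
    · linarith [hmono k (k + 1) (by omega) h]
    · linarith [hRL k hk]
  have hdnn : ∀ k ≤ N, 0 ≤ d k := by
    intro k
    induction k with
    | zero => intro _; exact hd0.ge
    | succ k ih => intro h; exact (ih (by omega)).trans (hdlt k (by omega)).le
  have hdpos : ∀ k, 1 ≤ k → k ≤ N → 0 < d k := by
    intro k h1 h2
    obtain ⟨m, rfl⟩ : ∃ m, k = m + 1 := ⟨k - 1, by omega⟩
    exact (hdnn m (by omega)).trans_lt (hdlt m (by omega))
  have hterm : ∀ k < N, 0 < ((d (k + 1)) ^ 2 - (d k) ^ 2) / (R k) ^ 2 := by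
    intro k hk
    have h1 := hdlt k hk
    have h2 := hdnn k hk.le
    exact div_pos (by nlinarith) (pow_pos (hpos k hk) 2)
  have hsum : 0 < ∑ k ∈ Finset.range N, ((d (k + 1)) ^ 2 - (d k) ^ 2) / (R k) ^ 2 :=
    Finset.sum_pos (fun k hk => hterm k (Finset.mem_range.1 hk)) ⟨0, Finset.mem_range.2 hN⟩
  have hc : 0 < c2 := by rw [hc2]; exact inv_pos.2 hsum
  have h1 : ∀ k < N, 0 < tstar k := by
    intro k hk
    rw [htstar, mul_div_assoc]
    exact mul_pos hc (hterm k hk)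
  have h2 : ∑ k ∈ Finset.range N, tstar k = 1 := by
    simp_rw [htstar, mul_div_assoc]
    rw [← Finset.mul_sum, hc2]
    exact inv_mul_cancel₀ hsum.ne'
  have h3' : ∀ i, i ≤ N → S tstar i = c2 * (d i) ^ 2 := by
    intro i
    induction i with
    | zero => intro _; rw [hS, hd0]; simp
    | succ i ih =>
      intro hi
      have hne : (R i) ^ 2 ≠ 0 := (pow_pos (hpos i (by omega)) 2).ne'
      have e := ih (by omega)
      rw [hS] at e
      rw [hS, Finset.sum_range_succ, e, htstar, div_mul_cancel₀ _ hne]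
      ring
  have hratio : ∀ j, 1 ≤ j → j ≤ N → Real.sqrt (S tstar j) / d j = Real.sqrt c2 := by
    intro j hj1 hj2
    have hp := hdpos j hj1 hj2
    rw [h3' j hj2, Real.sqrt_mul hc.le, Real.sqrt_sq hp.le, mul_div_cancel_right₀ _ hp.ne']
  have h4 : lam tstar = Real.sqrt c2 / 48 := by
    have : Finset.inf' (Finset.Icc 1 N) (Finset.nonempty_Icc.mpr hN)
        (fun j => Real.sqrt (S tstar j) / d j) = Real.sqrt c2 := by
      apply le_antisymm
      · exact (Finset.inf'_le _ (Finset.mem_Icc.2 ⟨hN, le_rfl⟩)).trans (hratio N hN le_rfl).le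
      · apply Finset.le_inf'
        intro j hj
        rw [Finset.mem_Icc] at hj
        exact (hratio j hj.1 hj.2).ge
    rw [hlam, this]
    ring
  have key : ∀ t : ℕ → ℝ, (∀ k < N, 0 ≤ t k) → (∑ k ∈ Finset.range N, t k = 1) →
      lam tstar ≤ lam t → ∀ k < N, t k = tstar k := by
    intro t ht hts hle
    rw [h4, hlam] at hle
    have hle' : Real.sqrt c2 ≤ Finset.inf' (Finset.Icc 1 N) (Finset.nonempty_Icc.mpr hN)
        (fun j => Real.sqrt (S t j) / d j) := by linarith
    rw [Finset.le_inf'_iff] at hle'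
    have hP : ∀ j, 1 ≤ j → j ≤ N →
        0 ≤ ∑ k ∈ Finset.range j, (t k - tstar k) * (R k) ^ 2 := by
      intro j hj1 hj2
      have hp := hdpos j hj1 hj2
      have h := hle' j (Finset.mem_Icc.2 ⟨hj1, hj2⟩)
      rw [le_div_iff₀ hp] at h
      have hSn : 0 ≤ S t j := by
        rw [hS]
        refine Finset.sum_nonneg fun k hk => mul_nonneg (ht k ?_) (sq_nonneg _)
        have := Finset.mem_range.1 hk
        omega
      have hq : (Real.sqrt c2 * d j) ^ 2 ≤ (Real.sqrt (S t j)) ^ 2 :=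
        pow_le_pow_left₀ (by positivity) h 2
      rw [mul_pow, Real.sq_sqrt hc.le, Real.sq_sqrt hSn, ← h3' j hj2, hS, hS] at hq
      simp_rw [sub_mul]
      rw [Finset.sum_sub_distrib]
      linarith
    obtain ⟨m, rfl⟩ : ∃ m, N = m + 1 := ⟨N - 1, by omega⟩
    have := (aux_unique (m + 1) R (fun k => t k - tstar k) hpos hmono hP m le_rfl).2
      (by rw [Finset.sum_sub_distrib, hts, h2, sub_self])
    intro k hk
    exact sub_eq_zero.1 (this k hk)
  refine ⟨h1, h2, fun i _ hi => h3' i hi, h4, ?_⟩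
  intro t ht hts
  refine ⟨?_, fun h => key t ht hts h.ge⟩
  by_contra hlt
  push Not at hlt
  have heq := key t ht hts hlt.le
  apply hlt.ne
  rw [hlam, hlam]
  congr 1
  apply Finset.inf'_congr _ rfl
  intro j hj
  rw [Finset.mem_Icc] at hj
  have : S t j = S tstar j := by
    rw [hS, hS]
    refine Finset.sum_congr rfl fun k hk => ?_
    have := Finset.mem_range.1 hk
    rw [heq k (by omega)]
  simp only [this]
end

section
/- Let R > 0 and 0 < Δ ≤ 2R/3, set r := R − Δ/2, and let P₊ and P₋ be the uniform probability measures on the real intervals [Δ/2 − r, Δ/2 + r] and [−Δ/2 − r, −Δ/2 + r]. Then for every integer m ≥ 1, the total variation distance between the m-fold product measures satisfies TV( P₊^{⊗m}, P₋^{⊗m} ) ≤ √( 3mΔ / (2R) ). In particular TV( P₊^{⊗m}, P₋^{⊗m} ) ≤ 1/2 whenever m ≤ R/(6Δ). -/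
open MeasureTheory

lemma aux_restrict_bound {m : ℕ} (P Q : Measure ℝ) [IsProbabilityMeasure P] [IsProbabilityMeasure Q]
    (C : Set ℝ) (hC : MeasurableSet C) (h : P.restrict C = Q.restrict C)
    (s : Set (Fin m → ℝ)) :
    |(Measure.pi fun _ : Fin m => P).real s - (Measure.pi fun _ : Fin m => Q).real s| ≤
      1 - (P.real C) ^ m := by
  have key : ∀ (P : Measure ℝ) [IsProbabilityMeasure P],
      ((Measure.pi fun _ : Fin m => P.restrict C)).real s ≤
        (Measure.pi fun _ : Fin m => P).real s ∧
      (Measure.pi fun _ : Fin m => P).real s ≤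
        ((Measure.pi fun _ : Fin m => P.restrict C)).real s + (1 - (P.real C) ^ m) := by
    intro P _
    have hT : MeasurableSet (Set.univ.pi fun _ : Fin m => C) :=
      MeasurableSet.univ_pi fun _ => hC
    have h1 : (Measure.pi fun _ : Fin m => P.restrict C) =
        (Measure.pi fun _ : Fin m => P).restrict (Set.univ.pi fun _ : Fin m => C) :=
      (Measure.restrict_pi_pi (fun _ : Fin m => P) (fun _ => C)).symm
    have h2 : (Measure.pi fun _ : Fin m => P).real (Set.univ.pi fun _ : Fin m => C)
        = (P.real C) ^ m := by
      simp [measureReal_def, Measure.pi_pi]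
    rw [h1, ← h2, measureReal_restrict_apply' hT, ← probReal_compl_eq_one_sub hT]
    refine ⟨measureReal_mono Set.inter_subset_left, ?_⟩
    rw [← measureReal_inter_add_sdiff (s := s) hT]
    exact add_le_add le_rfl (measureReal_mono (fun x hx => hx.2))
  have hPQ : P.real C = Q.real C := by
    have := congrArg (fun μ : Measure ℝ => μ.real Set.univ) h
    simpa using this
  have kP := key P
  have kQ := key Q
  rw [← h, ← hPQ] at kQ
  rw [abs_le]
  constructor <;> linarith [kP.1, kP.2, kQ.1, kQ.2]

/-- Total-variation closeness of the `m`-fold products of the two uniform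
interval laws: with `r = R − Δ/2`, `0 < Δ ≤ 2R/3`, for every measurable set
`s ⊆ ℝ^m`, `|P₊^{⊗m}(s) − P₋^{⊗m}(s)| ≤ √(3mΔ/(2R))`, and this is at most
`1/2` whenever `m ≤ R/(6Δ)`. -/
theorem stmt12 (R Δ : ℝ) (hR : 0 < R) (hΔ : 0 < Δ) (hΔR : Δ ≤ 2 * R / 3)
    (r : ℝ) (hrdef : r = R - Δ / 2)
    (Pp Pm : Measure ℝ)
    (hPp : Pp = (ENNReal.ofReal (2 * r))⁻¹ •
      volume.restrict (Set.Icc (Δ / 2 - r) (Δ / 2 + r)))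
    (hPm : Pm = (ENNReal.ofReal (2 * r))⁻¹ •
      volume.restrict (Set.Icc (-(Δ / 2) - r) (-(Δ / 2) + r)))
    (m : ℕ) (hm : 1 ≤ m)
    (s : Set (Fin m → ℝ)) (hs : MeasurableSet s) :
    |((Measure.pi fun _ : Fin m => Pp) s).toReal -
        ((Measure.pi fun _ : Fin m => Pm) s).toReal| ≤
      Real.sqrt (3 * m * Δ / (2 * R)) ∧
    ((m : ℝ) ≤ R / (6 * Δ) →
      |((Measure.pi fun _ : Fin m => Pp) s).toReal -
          ((Measure.pi fun _ : Fin m => Pm) s).toReal| ≤ 1 / 2) := by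
  have hr : 2 * R / 3 ≤ r := by linarith
  have hr0 : 0 < r := by linarith
  have h2r : ENNReal.ofReal (2 * r) ≠ 0 := by simpa using hr0
  have hp : IsProbabilityMeasure Pp := ⟨by
    rw [hPp]
    simp only [Measure.smul_apply, Measure.restrict_apply_univ, Real.volume_Icc, smul_eq_mul]
    rw [show Δ / 2 + r - (Δ / 2 - r) = 2 * r by ring]
    exact ENNReal.inv_mul_cancel h2r ENNReal.ofReal_ne_top⟩
  have hq : IsProbabilityMeasure Pm := ⟨by
    rw [hPm]
    simp only [Measure.smul_apply, Measure.restrict_apply_univ, Real.volume_Icc, smul_eq_mul]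
    rw [show -(Δ / 2) + r - (-(Δ / 2) - r) = 2 * r by ring]
    exact ENNReal.inv_mul_cancel h2r ENNReal.ofReal_ne_top⟩
  set C : Set ℝ := Set.Icc (Δ / 2 - r) (-(Δ / 2) + r) with hCdef
  have hC : MeasurableSet C := measurableSet_Icc
  have s1 : C ∩ Set.Icc (Δ / 2 - r) (Δ / 2 + r) = C :=
    Set.inter_eq_left.2 (Set.Icc_subset_Icc le_rfl (by linarith))
  have s2 : C ∩ Set.Icc (-(Δ / 2) - r) (-(Δ / 2) + r) = C :=
    Set.inter_eq_left.2 (Set.Icc_subset_Icc (by linarith) le_rfl)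
  have h : Pp.restrict C = Pm.restrict C := by
    rw [hPp, hPm, Measure.restrict_smul, Measure.restrict_smul, Measure.restrict_restrict hC,
      Measure.restrict_restrict hC, s1, s2]
  have hval : Pp.real C = 1 - Δ / (2 * r) := by
    rw [hPp, measureReal_def, Measure.smul_apply, Measure.restrict_apply hC, s1, hCdef,
      Real.volume_Icc, smul_eq_mul, ENNReal.toReal_mul, ENNReal.toReal_inv,
      ENNReal.toReal_ofReal (by linarith), ENNReal.toReal_ofReal (by linarith)]
    field_simp
    ring
  have hb := aux_restrict_bound Pp Pm C hC h s
  simp only [measureReal_def] at hb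
  have hd : Δ / (2 * r) ≤ 3 * Δ / (4 * R) := by
    rw [div_le_div_iff₀ (by linarith) (by linarith)]
    nlinarith
  have hpow : 1 - (m : ℝ) * (Δ / (2 * r)) ≤ (Pp.real C) ^ m := by
    have h0 : 0 ≤ Pp.real C := measureReal_nonneg
    have := one_add_mul_le_pow (a := Pp.real C - 1) (by linarith) m
    rw [add_sub_cancel] at this
    rw [hval] at this ⊢
    linarith
  have hpow0 : 0 ≤ (Pp.real C) ^ m := pow_nonneg measureReal_nonneg m
  have hx : 3 * (m : ℝ) * Δ / (2 * R) = 2 * (m * (3 * Δ / (4 * R))) := by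
    field_simp
    ring
  have hmd : (m : ℝ) * (Δ / (2 * r)) ≤ m * (3 * Δ / (4 * R)) :=
    mul_le_mul_of_nonneg_left hd (Nat.cast_nonneg m)
  rw [← measureReal_def Pp C] at hb
  set d := |((Measure.pi fun _ : Fin m => Pp) s).toReal -
        ((Measure.pi fun _ : Fin m => Pm) s).toReal| with hdd
  have hd0 : 0 ≤ d := abs_nonneg _
  have hmain : d ≤ Real.sqrt (3 * m * Δ / (2 * R)) := by
    apply Real.le_sqrt_of_sq_le
    rw [hx]
    nlinarith
  refine ⟨hmain, fun hmR => ?_⟩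
  rw [le_div_iff₀ (by linarith)] at hmR
  have hq4 : 3 * (m : ℝ) * Δ / (2 * R) ≤ 1 / 4 := by
    rw [div_le_iff₀ (by linarith)]
    linarith
  linarith
end

section
/- Let R > 0 and 0 < Δ ≤ 2R/3, set r := R − Δ/2, and let P₊ and P₋ be the uniform probability measures on the real intervals [Δ/2 − r, Δ/2 + r] and [−Δ/2 − r, −Δ/2 + r]. Then for every integer m with 1 ≤ m ≤ R/(6Δ) and every measurable test ψ : ℝ^m → {+1, −1}, max( P₊^{⊗m}( ψ ≠ +1 ), P₋^{⊗m}( ψ ≠ −1 ) ) ≥ 1/4. Consequently no procedure can identify which of the two Δ-mean-separated, R-bounded uniform laws generated the sample with worst-case error probability below 1/4 at sample sizes m ≤ R/(6Δ). -/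
open MeasureTheory
open scoped ENNReal

/-- Le Cam two-point lower bound in the sample-starved regime: with
`r = R − Δ/2`, `0 < Δ ≤ 2R/3`, for every sample size `1 ≤ m ≤ R/(6Δ)` and
every measurable test `ψ : ℝ^m → {+1, −1}` (encoded as `Bool`, `true = +1`),
`max(P₊^{⊗m}(ψ ≠ +1), P₋^{⊗m}(ψ ≠ −1)) ≥ 1/4`. -/
theorem stmt13 (R Δ : ℝ) (hR : 0 < R) (hΔ : 0 < Δ) (hΔR : Δ ≤ 2 * R / 3)
    (r : ℝ) (hrdef : r = R - Δ / 2)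
    (Pp Pm : Measure ℝ)
    (hPp : Pp = (ENNReal.ofReal (2 * r))⁻¹ •
      volume.restrict (Set.Icc (Δ / 2 - r) (Δ / 2 + r)))
    (hPm : Pm = (ENNReal.ofReal (2 * r))⁻¹ •
      volume.restrict (Set.Icc (-(Δ / 2) - r) (-(Δ / 2) + r)))
    (m : ℕ) (hm : 1 ≤ m) (hmR : (m : ℝ) ≤ R / (6 * Δ))
    (ψ : (Fin m → ℝ) → Bool) (hψ : Measurable ψ) :
    (1 / 4 : ℝ≥0∞) ≤
      max ((Measure.pi fun _ : Fin m => Pp) {x | ψ x ≠ true})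
          ((Measure.pi fun _ : Fin m => Pm) {x | ψ x ≠ false}) := by
  have hr : 0 < r := by rw [hrdef]; linarith
  have hmΔ : (m : ℝ) * (6 * Δ) ≤ R := (le_div_iff₀ (by positivity)).1 hmR
  set c : ℝ≥0∞ := (ENNReal.ofReal (2 * r))⁻¹ with hc
  have hctop : c ≠ ∞ := by
    rw [hc]; simp [hr]
  set I : Set ℝ := Set.Icc (Δ / 2 - r) (-(Δ / 2) + r) with hI
  have hIm : MeasurableSet I := measurableSet_Icc
  have hp : Pp.restrict I = c • volume.restrict I := by
    rw [hPp, Measure.restrict_smul, Measure.restrict_restrict hIm,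
      Set.inter_eq_left.2 (Set.Icc_subset_Icc (by linarith) (by linarith))]
  have hq : Pm.restrict I = c • volume.restrict I := by
    rw [hPm, Measure.restrict_smul, Measure.restrict_restrict hIm,
      Set.inter_eq_left.2 (Set.Icc_subset_Icc (by linarith) (by linarith))]
  have : IsFiniteMeasure Pp := by
    rw [hPp]; exact Measure.smul_finite _ hctop
  have : IsFiniteMeasure Pm := by
    rw [hPm]; exact Measure.smul_finite _ hctop
  have : IsFiniteMeasure (c • volume.restrict I : Measure ℝ) := by
    exact Measure.smul_finite _ hctop
  set Q : Measure (Fin m → ℝ) := Measure.pi fun _ : Fin m => c • volume.restrict I with hQ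
  have hQp : Q ≤ Measure.pi fun _ : Fin m => Pp := by
    rw [hQ, ← hp, ← Measure.restrict_pi_pi]
    exact Measure.restrict_le_self
  have hQq : Q ≤ Measure.pi fun _ : Fin m => Pm := by
    rw [hQ, ← hq, ← Measure.restrict_pi_pi]
    exact Measure.restrict_le_self
  have hmass : (1 / 2 : ℝ≥0∞) ≤ Q Set.univ := by
    have h1 : (c • volume.restrict I : Measure ℝ) Set.univ
        = ENNReal.ofReal (1 - Δ / (2 * r)) := by
      rw [Measure.smul_apply, Measure.restrict_apply_univ, hI, Real.volume_Icc, smul_eq_mul, hc,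
        ← ENNReal.ofReal_inv_of_pos (by positivity), ← ENNReal.ofReal_mul (by positivity)]
      congr 1
      field_simp
      ring
    have hle : Δ / (2 * r) ≤ 1 := by
      rw [div_le_one (by positivity)]; linarith
    rw [hQ, Measure.pi_univ, Finset.prod_congr rfl (fun _ _ => h1), Finset.prod_const,
      ← ENNReal.ofReal_pow (by linarith)]
    have h2 : (1 / 2 : ℝ≥0∞) = ENNReal.ofReal (1 / 2) := by
      rw [ENNReal.ofReal_div_of_pos (by norm_num)]; simp
    rw [h2]
    apply ENNReal.ofReal_le_ofReal
    have hb := one_add_mul_le_pow (a := -(Δ / (2 * r))) (by linarith) m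
    have h3 : (m : ℝ) * (Δ / (2 * r)) ≤ 1 / 2 := by
      rw [← mul_div_assoc, div_le_iff₀ (by positivity)]
      linarith
    rw [← sub_eq_add_neg, mul_neg] at hb
    rw [Finset.card_univ, Fintype.card_fin]
    linarith
  have hsplit : Q Set.univ ≤ Q {x | ψ x ≠ true} + Q {x | ψ x ≠ false} := by
    refine le_trans (measure_mono ?_) (measure_union_le _ _)
    intro x _
    cases h : ψ x <;> simp [h]
  have h1 := hQp {x | ψ x ≠ true}
  have h2 := hQq {x | ψ x ≠ false}
  by_contra hcon
  rw [not_le, max_lt_iff] at hcon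
  have h3 := ENNReal.add_lt_add (h1.trans_lt hcon.1) (h2.trans_lt hcon.2)
  have h4 : (1 / 4 : ℝ≥0∞) + 1 / 4 = 1 / 2 := by
    rw [← ENNReal.toReal_eq_toReal_iff' (by simp) (by simp),
      ENNReal.toReal_add (by simp) (by simp)]
    norm_num
  rw [h4] at h3
  exact absurd (hmass.trans hsplit) (not_le.2 h3)
end

section
/- Let ℓ ≥ 1 be an integer, r > 0, and μ ∈ ℝ^ℓ with 0 ≤ ‖μ‖ ≤ r (Euclidean norm). Let B(x, r) denote the closed Euclidean ball of radius r centered at x, and let vol denote ℓ-dimensional Lebesgue measure. Then vol( B(0, r) ) − vol( B(μ, r) ∩ B(−μ, r) ) = 2 ∫₀^{‖μ‖} V_{ℓ−1}( √(r² − u²) ) du ≤ 2 ‖μ‖ · V_{ℓ−1}(r), where V_{d}(ρ) denotes the d-dimensional Lebesgue volume of a Euclidean ball of radius ρ in ℝ^d (with V₀(ρ) := 1). -/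
open MeasureTheory

/-- `Vd d ρ` is the `d`-dimensional Lebesgue volume of a Euclidean ball of
radius `ρ` in `ℝ^d` (for `d = 0` this is `1`, the total mass of the
zero-dimensional volume). -/
noncomputable def Vd (d : ℕ) (ρ : ℝ) : ℝ :=
  (volume (Metric.closedBall (0 : EuclideanSpace ℝ (Fin d)) ρ)).toReal

/-- A linear isometry onto `ℝ × ℝ^n` taking `μ` to the first axis. -/
lemma exists_rot (n : ℕ) (μ : EuclideanSpace ℝ (Fin (n + 1))) :
    ∃ f : EuclideanSpace ℝ (Fin (n + 1)) ≃ₗᵢ[ℝ] WithLp 2 (ℝ × EuclideanSpace ℝ (Fin n)),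
      f μ = WithLp.toLp 2 (‖μ‖, 0) := by
  have h : Module.finrank ℝ (WithLp 2 (ℝ × EuclideanSpace ℝ (Fin n))) = n + 1 := by
    rw [(WithLp.linearEquiv 2 ℝ (ℝ × EuclideanSpace ℝ (Fin n))).finrank_eq]
    simp [add_comm]
  let g := (((stdOrthonormalBasis ℝ
    (WithLp 2 (ℝ × EuclideanSpace ℝ (Fin n)))).reindex (finCongr h)).repr).symm
  have hn : ‖g μ‖ = ‖(WithLp.toLp 2 (‖μ‖, 0) : WithLp 2 (ℝ × EuclideanSpace ℝ (Fin n)))‖ := by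
    rw [LinearIsometryEquiv.norm_map]
    simp
  exact ⟨g.trans (Submodule.reflection _), by
    simpa using Submodule.reflection_sub hn⟩

/-- The slice volume. -/
noncomputable def sliceVol (n : ℕ) (r t : ℝ) : ℝ :=
  (volume : Measure (EuclideanSpace ℝ (Fin n))).real {y | t ^ 2 + ‖y‖ ^ 2 ≤ r ^ 2}

lemma volume_slices {n : ℕ}
    (f : EuclideanSpace ℝ (Fin (n + 1)) ≃ₗᵢ[ℝ] WithLp 2 (ℝ × EuclideanSpace ℝ (Fin n)))
    (A : Set (EuclideanSpace ℝ (Fin (n + 1)))) (hA : volume A ≠ ⊤)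
    (S : Set (ℝ × EuclideanSpace ℝ (Fin n))) (hS : MeasurableSet S)
    (h : ∀ x, x ∈ A ↔ (f x).ofLp ∈ S) :
    Integrable (fun t => (volume : Measure (EuclideanSpace ℝ (Fin n))).real (Prod.mk t ⁻¹' S)) ∧
    (volume A).toReal =
      ∫ t, (volume : Measure (EuclideanSpace ℝ (Fin n))).real (Prod.mk t ⁻¹' S) := by
  have mp := (WithLp.volume_preserving_ofLp ℝ (EuclideanSpace ℝ (Fin n))).comp f.measurePreserving
  have e : volume A = (volume : Measure (ℝ × EuclideanSpace ℝ (Fin n))) S := by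
    rw [← mp.measure_preimage hS.nullMeasurableSet]
    congr 1
    ext x
    exact h x
  have hfin : ((volume : Measure ℝ).prod (volume : Measure (EuclideanSpace ℝ (Fin n)))) S ≠ ⊤ := by
    rw [← Measure.volume_eq_prod, ← e]; exact hA
  refine ⟨Measure.integrable_measure_prodMk_left hS hfin, ?_⟩
  rw [e, Measure.volume_eq_prod, Measure.prod_apply hS]
  simp only [measureReal_def]
  rw [integral_toReal (measurable_measure_prodMk_left hS).aemeasurable]
  exact Measure.ae_measure_lt_top hS hfin

lemma mem_closedBall_sq {n : ℕ} (r : ℝ) (hr : 0 < r)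
    (f : EuclideanSpace ℝ (Fin (n + 1)) ≃ₗᵢ[ℝ] WithLp 2 (ℝ × EuclideanSpace ℝ (Fin n)))
    (c : ℝ) (v x : EuclideanSpace ℝ (Fin (n + 1))) (hv : f v = WithLp.toLp 2 (c, 0)) :
    x ∈ Metric.closedBall v r ↔ ((f x).ofLp.1 - c) ^ 2 + ‖(f x).ofLp.2‖ ^ 2 ≤ r ^ 2 := by
  rw [mem_closedBall_iff_norm, ← f.norm_map, ← sq_le_sq₀ (norm_nonneg _) hr.le,
    WithLp.prod_norm_sq_eq_of_L2, map_sub, hv]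
  simp

theorem stmt14 (ℓ : ℕ) (hℓ : 1 ≤ ℓ) (r : ℝ) (hr : 0 < r)
    (μ : EuclideanSpace ℝ (Fin ℓ)) (hμ : ‖μ‖ ≤ r) :
    (volume (Metric.closedBall (0 : EuclideanSpace ℝ (Fin ℓ)) r)).toReal -
        (volume (Metric.closedBall μ r ∩ Metric.closedBall (-μ) r)).toReal =
      2 * ∫ u in (0 : ℝ)..‖μ‖, Vd (ℓ - 1) (Real.sqrt (r ^ 2 - u ^ 2)) ∧
    (volume (Metric.closedBall (0 : EuclideanSpace ℝ (Fin ℓ)) r)).toReal -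
        (volume (Metric.closedBall μ r ∩ Metric.closedBall (-μ) r)).toReal ≤
      2 * ‖μ‖ * Vd (ℓ - 1) r := by
  obtain ⟨n, rfl⟩ : ∃ n, ℓ = n + 1 := ⟨ℓ - 1, by omega⟩
  simp only [Nat.add_sub_cancel]
  obtain ⟨f, hf⟩ := exists_rot n μ
  have hm0 : 0 ≤ ‖μ‖ := norm_nonneg μ
  generalize hm : ‖μ‖ = m at *
  have hlt : volume (Metric.closedBall (0 : EuclideanSpace ℝ (Fin (n + 1))) r) ≠ ⊤ :=
    measure_closedBall_lt_top.ne
  have hlt2 : volume (Metric.closedBall μ r ∩ Metric.closedBall (-μ) r) ≠ ⊤ :=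
    ((measure_mono Set.inter_subset_left).trans_lt measure_closedBall_lt_top).ne
  obtain ⟨hi, h1⟩ := volume_slices f _ hlt {p | p.1 ^ 2 + ‖p.2‖ ^ 2 ≤ r ^ 2}
    (measurableSet_le (by fun_prop) (by fun_prop)) (by
      intro x
      rw [mem_closedBall_sq r hr f 0 0 x (by simp; rfl)]
      simp)
  obtain ⟨-, h2⟩ := volume_slices f _ hlt2 {p | (|p.1| + m) ^ 2 + ‖p.2‖ ^ 2 ≤ r ^ 2}
    (measurableSet_le (by fun_prop) (by fun_prop)) (by
      intro x
      rw [Set.mem_inter_iff, mem_closedBall_sq r hr f m μ x hf,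
        mem_closedBall_sq r hr f (-m) (-μ) x (by
          rw [map_neg, hf, ← WithLp.toLp_neg]; simp)]
      simp only [Set.mem_setOf_eq]
      rcases abs_cases (f x).ofLp.1 with ⟨h, h'⟩ | ⟨h, h'⟩ <;> rw [h] <;> constructor
      · rintro ⟨a, b⟩; nlinarith
      · intro a; constructor <;> nlinarith
      · rintro ⟨a, b⟩; nlinarith
      · intro a; constructor <;> nlinarith)
  have hi' : Integrable (sliceVol n r) := hi
  have h1' : (volume (Metric.closedBall (0 : EuclideanSpace ℝ (Fin (n + 1))) r)).toReal
      = 2 * ∫ t in Set.Ioi (0 : ℝ), sliceVol n r t := by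
    rw [h1, ← integral_comp_abs]
    congr 1; ext t
    simp [sliceVol]
  have h2' : (volume (Metric.closedBall μ r ∩ Metric.closedBall (-μ) r)).toReal
      = 2 * ∫ t in Set.Ioi m, sliceVol n r t := by
    have := (measurePreserving_add_right (volume : Measure ℝ) m).setIntegral_preimage_emb
      (measurableEmbedding_addRight m) (sliceVol n r) (Set.Ioi m)
    rw [h2, ← this]
    have e : (fun x => x + m) ⁻¹' Set.Ioi m = Set.Ioi (0 : ℝ) := by ext; simp
    rw [e, ← integral_comp_abs (f := fun t => sliceVol n r (t + m))]
    rfl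
  have hV : ∀ u ∈ Set.Icc (0 : ℝ) m, Vd n (Real.sqrt (r ^ 2 - u ^ 2)) = sliceVol n r u := by
    intro u hu
    have : 0 ≤ r ^ 2 - u ^ 2 := by nlinarith [hu.1, hu.2]
    unfold Vd sliceVol
    rw [measureReal_def]
    congr 2
    ext y
    rw [mem_closedBall_zero_iff, Real.le_sqrt (norm_nonneg _) this, Set.mem_setOf_eq]
    constructor <;> intro h <;> linarith
  have hV' : ∀ u, sliceVol n r u ≤ Vd n r := by
    intro u
    unfold Vd sliceVol
    apply ENNReal.toReal_mono measure_closedBall_lt_top.ne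
    apply measure_mono
    intro y hy
    rw [mem_closedBall_zero_iff, ← sq_le_sq₀ (norm_nonneg _) hr.le]
    have : u ^ 2 + ‖y‖ ^ 2 ≤ r ^ 2 := hy
    nlinarith
  have hI : (∫ u in (0 : ℝ)..m, Vd n (Real.sqrt (r ^ 2 - u ^ 2)))
      = ∫ u in (0 : ℝ)..m, sliceVol n r u :=
    intervalIntegral.integral_congr (fun u hu => hV u (by rwa [Set.uIcc_of_le hm0] at hu))
  have key : (volume (Metric.closedBall (0 : EuclideanSpace ℝ (Fin (n + 1))) r)).toReal -
        (volume (Metric.closedBall μ r ∩ Metric.closedBall (-μ) r)).toReal =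
      2 * ∫ u in (0 : ℝ)..m, sliceVol n r u := by
    rw [h1', h2', ← mul_sub, intervalIntegral.integral_Ioi_sub_Ioi hi'.integrableOn hm0]
  refine ⟨by rw [key, hI], ?_⟩
  rw [key]
  have := intervalIntegral.integral_mono_on hm0 hi'.intervalIntegrable
    (intervalIntegrable_const (c := Vd n r)) (fun u _ => hV' u)
  rw [intervalIntegral.integral_const, smul_eq_mul] at this
  linarith
end

section
/- Let ℓ ≥ 1 be an integer, r > 0, and μ ∈ ℝ^ℓ with ‖μ‖ ≤ r/2 (Euclidean norm). Let P₊ and P₋ be the uniform probability measures on the closed Euclidean balls B(μ, r) and B(−μ, r) respectively. Then the squared Hellinger distance satisfies H²(P₊, P₋) = 1 − vol( B(μ,r) ∩ B(−μ,r) ) / vol( B(0,r) ) ≤ c_ℓ · ‖μ‖ / r, where c_ℓ := 2 V_{ℓ−1}(1) / V_ℓ(1) = (2/√π) · Γ(ℓ/2 + 1) / Γ((ℓ+1)/2), and V_d(1) = π^{d/2}/Γ(d/2+1) is the volume of the d-dimensional unit ball. -/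
open MeasureTheory

lemma Vd_formula (n : ℕ) (ρ : ℝ) (hρ : 0 < ρ) :
    Vd n ρ = ρ ^ n * (Real.sqrt Real.pi ^ n / Real.Gamma (n / 2 + 1)) := by
  unfold Vd
  rcases Nat.eq_zero_or_pos n with h | h
  · subst h
    have : Metric.closedBall (0 : EuclideanSpace ℝ (Fin 0)) ρ = Set.univ := by
      ext x
      simp [Subsingleton.elim x 0, hρ.le]
    rw [this, ← (EuclideanSpace.volume_preserving_symm_measurableEquiv_toLp (Fin 0)).symm.measure_preimage
      MeasurableSet.univ.nullMeasurableSet]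
    simp [MeasureTheory.volume_pi]
  · have : Nonempty (Fin n) := ⟨⟨0, h⟩⟩
    have hG : 0 < Real.Gamma ((n : ℝ) / 2 + 1) := Real.Gamma_pos_of_pos (by positivity)
    rw [EuclideanSpace.volume_closedBall, ENNReal.toReal_mul, ENNReal.toReal_pow,
      ENNReal.toReal_ofReal hρ.le, Fintype.card_fin, ENNReal.toReal_ofReal (by positivity)]

lemma slice_bound (n : ℕ) (r m : ℝ) (hm : 0 ≤ m) (hr : 0 < r) :
    volume {x : EuclideanSpace ℝ (Fin (n + 1)) |
      (x 0 - m) ^ 2 + ∑ i : Fin n, x i.succ ^ 2 ≤ r ^ 2 ∧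
      r ^ 2 < (x 0 + m) ^ 2 + ∑ i : Fin n, x i.succ ^ 2} ≤
    ENNReal.ofReal (2 * m) * volume (Metric.closedBall (0 : EuclideanSpace ℝ (Fin n)) r) := by
  have e1 := PiLp.volume_preserving_ofLp (Fin (n + 1))
  have e2 := volume_preserving_piFinSuccAbove (fun _ : Fin (n + 1) => ℝ) 0
  let S : Set (ℝ × (Fin n → ℝ)) := {p | (p.1 - m) ^ 2 + ∑ i : Fin n, p.2 i ^ 2 ≤ r ^ 2 ∧
      r ^ 2 < (p.1 + m) ^ 2 + ∑ i : Fin n, p.2 i ^ 2}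
  let T : Set (Fin n → ℝ) := {y | ∑ i : Fin n, y i ^ 2 ≤ r ^ 2}
  have hS : MeasurableSet S := by
    have m1 : MeasurableSet {p : ℝ × (Fin n → ℝ) | (p.1 - m) ^ 2 + ∑ i : Fin n, p.2 i ^ 2 ≤ r ^ 2} :=
      measurableSet_le (by fun_prop) (by fun_prop)
    have m2 : MeasurableSet {p : ℝ × (Fin n → ℝ) | r ^ 2 < (p.1 + m) ^ 2 + ∑ i : Fin n, p.2 i ^ 2} :=
      measurableSet_lt (by fun_prop) (by fun_prop)
    exact m1.inter m2
  have hT : MeasurableSet T := measurableSet_le (by fun_prop) (by fun_prop)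
  have hvS := (e2.comp e1).measure_preimage hS.nullMeasurableSet
  have hvT := (PiLp.volume_preserving_ofLp (Fin n)).measure_preimage hT.nullMeasurableSet
  have hTb : (WithLp.ofLp ⁻¹' T : Set (EuclideanSpace ℝ (Fin n))) = Metric.closedBall 0 r := by
    ext x
    simp only [Set.mem_preimage, Set.mem_ofPred_eq, mem_closedBall_zero_iff, T]
    rw [← EuclideanSpace.real_norm_sq_eq]
    exact pow_le_pow_iff_left₀ (norm_nonneg _) hr.le two_ne_zero
  rw [← hTb, hvT]
  refine le_trans (le_of_eq hvS) ?_
  rw [Measure.volume_eq_prod, Measure.prod_apply_symm hS, ← lintegral_indicator_const hT]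
  refine lintegral_mono fun y => ?_
  by_cases hy : y ∈ T
  · rw [Set.indicator_of_mem hy]
    have hy' : 0 ≤ r ^ 2 - ∑ i : Fin n, y i ^ 2 := sub_nonneg.2 hy
    set s := Real.sqrt (r ^ 2 - ∑ i : Fin n, y i ^ 2) with hs
    have hs2 : s ^ 2 = r ^ 2 - ∑ i : Fin n, y i ^ 2 := Real.sq_sqrt hy'
    have hs0 : 0 ≤ s := Real.sqrt_nonneg _
    have : (fun x => (x, y)) ⁻¹' S ⊆ Set.Ioc (s - m) (s + m) := by
      rintro t ⟨h1, h2⟩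
      simp only at h1 h2
      have h3 : |t - m| ≤ s := abs_le_of_sq_le_sq (by linarith) hs0
      have h4 : s < |t + m| := by
        apply lt_of_pow_lt_pow_left₀ 2 (abs_nonneg _)
        rw [sq_abs]; linarith
      rw [abs_le] at h3
      rw [lt_abs] at h4
      constructor
      · rcases h4 with h | h <;> linarith
      · linarith
    refine (measure_mono this).trans ?_
    rw [Real.volume_Ioc]
    apply ENNReal.ofReal_le_ofReal
    linarith
  · have : (fun x => (x, y)) ⁻¹' S = ∅ := by
      ext t
      simp only [Set.mem_preimage, Set.mem_empty_iff_false, iff_false]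
      rintro ⟨h1, -⟩
      apply hy
      have := sq_nonneg (t - m)
      simp only at h1
      show ∑ i : Fin n, y i ^ 2 ≤ r ^ 2
      linarith
    rw [this]; simp

lemma diff_bound (n : ℕ) (r : ℝ) (hr : 0 < r) (μ : EuclideanSpace ℝ (Fin (n + 1))) :
    volume (Metric.closedBall μ r \ Metric.closedBall (-μ) r) ≤
    ENNReal.ofReal (2 * ‖μ‖) * volume (Metric.closedBall (0 : EuclideanSpace ℝ (Fin n)) r) := by
  refine le_trans ?_ (slice_bound n r ‖μ‖ (norm_nonneg _) hr)
  let w : EuclideanSpace ℝ (Fin (n + 1)) := EuclideanSpace.single 0 ‖μ‖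
  have hw : ‖μ‖ = ‖w‖ := by simp [w]
  obtain ⟨R, hR⟩ : ∃ R : EuclideanSpace ℝ (Fin (n + 1)) ≃ₗᵢ[ℝ] EuclideanSpace ℝ (Fin (n + 1)),
      R μ = w := ⟨_, Submodule.reflection_sub hw⟩
  rw [← (show MeasurePreserving R.toMeasurableEquiv volume volume from R.measurePreserving).measure_preimage_equiv
    {x | (x 0 - ‖μ‖) ^ 2 + ∑ i : Fin n, x i.succ ^ 2 ≤ r ^ 2 ∧
      r ^ 2 < (x 0 + ‖μ‖) ^ 2 + ∑ i : Fin n, x i.succ ^ 2}]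
  apply measure_mono
  rintro x ⟨h1, h2⟩
  rw [Metric.mem_closedBall, dist_eq_norm] at h1 h2
  have key : ∀ z : EuclideanSpace ℝ (Fin (n + 1)), ‖z‖ ^ 2 = z 0 ^ 2 + ∑ i : Fin n, z i.succ ^ 2 := by
    intro z
    rw [EuclideanSpace.real_norm_sq_eq, Fin.sum_univ_succ]
  have a1 : ‖x - μ‖ = ‖R x - w‖ := by rw [← hR, ← map_sub, R.norm_map]
  have a2 : ‖x - -μ‖ = ‖R x + w‖ := by rw [← hR, ← map_add, R.norm_map, sub_neg_eq_add]
  rw [a1] at h1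
  rw [a2, not_le] at h2
  have b1 := pow_le_pow_left₀ (norm_nonneg _) h1 2
  have b2 := pow_lt_pow_left₀ h2 hr.le two_ne_zero
  rw [key] at b1 b2
  simp [w] at b1 b2
  exact ⟨b1, b2⟩

lemma hell_eq {E : Type*} [MeasurableSpace E] (ν lam : Measure E) [SigmaFinite lam]
    (A B : Set E) (hA : MeasurableSet A) (hB : MeasurableSet B) (c : ENNReal) (hc : c ≠ ⊤)
    (hAf : ν A ≠ ⊤) (hBf : ν B ≠ ⊤)
    (h1 : c • ν.restrict A ≪ lam) (h2 : c • ν.restrict B ≪ lam) :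
    ∫ x, (Real.sqrt (((c • ν.restrict A).rnDeriv lam x).toReal) -
        Real.sqrt (((c • ν.restrict B).rnDeriv lam x).toReal)) ^ 2 ∂lam =
      (c * ν (A \ B)).toReal + (c * ν (B \ A)).toReal := by
  set Q : Measure E := c • ν.restrict (A ∪ B) with hQ
  have hUf : ν (A ∪ B) ≠ ⊤ := measure_union_ne_top hAf hBf
  have : IsFiniteMeasure Q := by
    refine ⟨?_⟩
    simp [hQ]
    exact ENNReal.mul_lt_top hc.lt_top hUf.lt_top
  have hQl : Q ≪ lam := by
    refine Measure.AbsolutelyContinuous.mk fun s hs h0 => ?_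
    have k1 := h1 h0
    have k2 := h2 h0
    simp only [hQ, Measure.smul_apply, smul_eq_mul, mul_eq_zero, Measure.restrict_apply hs] at k1 k2 ⊢
    rcases k1 with k1 | k1
    · exact Or.inl k1
    rcases k2 with k2 | k2
    · exact Or.inl k2
    right
    rw [Set.inter_union_distrib_left]
    exact measure_union_null k1 k2
  have hQA : c • ν.restrict A = Q.restrict A := by
    rw [hQ, Measure.restrict_smul, Measure.restrict_restrict hA]
    congr 2; ext; simp; tauto
  have hQB : c • ν.restrict B = Q.restrict B := by
    rw [hQ, Measure.restrict_smul, Measure.restrict_restrict hB]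
    congr 2; ext; simp; tauto
  rw [hQA, hQB]
  have hD : MeasurableSet ((A \ B) ∪ (B \ A)) := (hA.diff hB).union (hB.diff hA)
  have : (fun x => (Real.sqrt (((Q.restrict A).rnDeriv lam x).toReal) -
        Real.sqrt (((Q.restrict B).rnDeriv lam x).toReal)) ^ 2) =ᵐ[lam]
      ((A \ B) ∪ (B \ A)).indicator (fun x => (Q.rnDeriv lam x).toReal) := by
    filter_upwards [Measure.rnDeriv_restrict Q lam hA, Measure.rnDeriv_restrict Q lam hB]
      with x ha hb
    rw [ha, hb]
    by_cases xa : x ∈ A <;> by_cases xb : x ∈ B <;> simp [xa, xb, Real.sq_sqrt]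
  rw [integral_congr_ae this, integral_indicator hD, Measure.setIntegral_toReal_rnDeriv hQl,
    measureReal_union (Set.disjoint_left.2 fun x hx hy => hx.2 hy.1) (hB.diff hA)]
  simp only [Measure.real, hQ, Measure.smul_apply, smul_eq_mul,
    Measure.restrict_apply (hA.diff hB), Measure.restrict_apply (hB.diff hA)]
  congr 4
  · ext; simp; tauto
  · ext; simp; tauto

/-- Hellinger bound for uniform distributions on translated Euclidean balls:
for `‖μ‖ ≤ r/2`, the squared Hellinger distance between the uniform laws on
`B(μ, r)` and `B(−μ, r)` equals `1 − vol(B(μ,r) ∩ B(−μ,r))/vol(B(0,r))` and is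
at most `c_ℓ ‖μ‖/r`, where `c_ℓ = 2V_{ℓ−1}(1)/V_ℓ(1) = (2/√π)Γ(ℓ/2+1)/Γ((ℓ+1)/2)`. -/
theorem stmt15 (ℓ : ℕ) (hℓ : 1 ≤ ℓ) (r : ℝ) (hr : 0 < r)
    (μ : EuclideanSpace ℝ (Fin ℓ)) (hμ : ‖μ‖ ≤ r / 2)
    (Pp Pm : Measure (EuclideanSpace ℝ (Fin ℓ)))
    (hPp : Pp = (volume (Metric.closedBall (0 : EuclideanSpace ℝ (Fin ℓ)) r))⁻¹ •
      volume.restrict (Metric.closedBall μ r))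
    (hPm : Pm = (volume (Metric.closedBall (0 : EuclideanSpace ℝ (Fin ℓ)) r))⁻¹ •
      volume.restrict (Metric.closedBall (-μ) r))
    (lam : Measure (EuclideanSpace ℝ (Fin ℓ))) [SigmaFinite lam]
    (hPpl : Pp ≪ lam) (hPml : Pm ≪ lam)
    (cℓ : ℝ)
    (hcℓ : cℓ = (2 / Real.sqrt Real.pi) *
      (Real.Gamma (ℓ / 2 + 1) / Real.Gamma ((ℓ + 1) / 2))) :
    cℓ = 2 * Vd (ℓ - 1) 1 / Vd ℓ 1 ∧
    (1 / 2) * ∫ x, (Real.sqrt ((Pp.rnDeriv lam x).toReal) -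
        Real.sqrt ((Pm.rnDeriv lam x).toReal)) ^ 2 ∂lam =
      1 - (volume (Metric.closedBall μ r ∩ Metric.closedBall (-μ) r)).toReal /
        (volume (Metric.closedBall (0 : EuclideanSpace ℝ (Fin ℓ)) r)).toReal ∧
    (1 / 2) * ∫ x, (Real.sqrt ((Pp.rnDeriv lam x).toReal) -
        Real.sqrt ((Pm.rnDeriv lam x).toReal)) ^ 2 ∂lam ≤ cℓ * ‖μ‖ / r := by
  obtain ⟨n, rfl⟩ : ∃ n, ℓ = n + 1 := ⟨ℓ - 1, by omega⟩
  have hc1 : cℓ = 2 * Vd (n + 1 - 1) 1 / Vd (n + 1) 1 := by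
    rw [hcℓ, Nat.add_sub_cancel, Vd_formula _ _ one_pos, Vd_formula _ _ one_pos]
    have g1 : 0 < Real.Gamma (((n + 1 : ℕ) : ℝ) / 2 + 1) := Real.Gamma_pos_of_pos (by positivity)
    have g2 : 0 < Real.Gamma ((n : ℝ) / 2 + 1) := Real.Gamma_pos_of_pos (by positivity)
    have : (((n + 1 : ℕ) : ℝ) + 1) / 2 = (n : ℝ) / 2 + 1 := by push_cast; ring
    rw [this]
    have hp : 0 < Real.sqrt Real.pi := Real.sqrt_pos.2 Real.pi_pos
    simp only [one_pow, one_mul]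
    generalize Real.Gamma (((n + 1 : ℕ) : ℝ) / 2 + 1) = a at *
    generalize Real.Gamma ((n : ℝ) / 2 + 1) = b at *
    generalize Real.sqrt Real.pi = p at *
    field_simp
    ring
  have hvol : ∀ z : EuclideanSpace ℝ (Fin (n + 1)), volume (Metric.closedBall z r) =
      volume (Metric.closedBall (0 : EuclideanSpace ℝ (Fin (n + 1))) r) := fun z =>
    Measure.addHaar_closedBall_center _ _ _
  set V := volume (Metric.closedBall (0 : EuclideanSpace ℝ (Fin (n + 1))) r) with hV
  have hV0 : V ≠ 0 := (Metric.measure_closedBall_pos _ _ hr).ne'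
  have hVt : V ≠ ⊤ := measure_closedBall_lt_top.ne
  have hVp : 0 < V.toReal := ENNReal.toReal_pos hV0 hVt
  subst hPp hPm
  have hH := hell_eq volume lam (Metric.closedBall μ r) (Metric.closedBall (-μ) r)
    measurableSet_closedBall measurableSet_closedBall V⁻¹ (ENNReal.inv_ne_top.2 hV0)
    (by rw [hvol]; exact hVt) (by rw [hvol]; exact hVt) hPpl hPml
  have d1 : (volume (Metric.closedBall μ r \ Metric.closedBall (-μ) r)).toReal =
      V.toReal - (volume (Metric.closedBall μ r ∩ Metric.closedBall (-μ) r)).toReal := by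
    have := measureReal_sdiff_add_inter (μ := volume) (s := Metric.closedBall μ r)
      (t := Metric.closedBall (-μ) r) measurableSet_closedBall (by rw [hvol]; exact hVt)
    simp only [Measure.real, hvol] at this
    linarith
  have d2 : (volume (Metric.closedBall (-μ) r \ Metric.closedBall μ r)).toReal =
      V.toReal - (volume (Metric.closedBall μ r ∩ Metric.closedBall (-μ) r)).toReal := by
    have := measureReal_sdiff_add_inter (μ := volume) (s := Metric.closedBall (-μ) r)
      (t := Metric.closedBall μ r) measurableSet_closedBall (by rw [hvol]; exact hVt)
    simp only [Measure.real, hvol] at this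
    rw [Set.inter_comm] at this
    linarith
  rw [ENNReal.toReal_mul, ENNReal.toReal_mul, d1, d2, ENNReal.toReal_inv] at hH
  have hbd := ENNReal.toReal_mono (ENNReal.mul_ne_top ENNReal.ofReal_ne_top
    measure_closedBall_lt_top.ne) (diff_bound n r hr μ)
  rw [d1, ENNReal.toReal_mul, ENNReal.toReal_ofReal (by positivity)] at hbd
  change _ ≤ 2 * ‖μ‖ * Vd n r at hbd
  have hVV : V.toReal = Vd (n + 1) r := rfl
  refine ⟨hc1, ?_, ?_⟩
  · rw [hH]
    field_simp
    ring
  · rw [hH, hc1, Nat.add_sub_cancel]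
    have e1 : Vd n r = r ^ n * Vd n 1 := by
      rw [Vd_formula _ _ hr, Vd_formula _ _ one_pos]; simp
    have e2 : Vd (n + 1) r = r ^ (n + 1) * Vd (n + 1) 1 := by
      rw [Vd_formula _ _ hr, Vd_formula _ _ one_pos]; simp
    have h1 : 0 < Vd (n + 1) 1 := by
      rw [hVV, e2] at hVp
      exact pos_of_mul_pos_right hVp (by positivity)
    calc _ = (V.toReal - (volume (Metric.closedBall μ r ∩ Metric.closedBall (-μ) r)).toReal)
          / V.toReal := by field_simp; ring
      _ ≤ (2 * ‖μ‖ * Vd n r) / V.toReal := by gcongr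
      _ = _ := by
        rw [hVV, e1, e2]
        field_simp
        ring
end
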